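/- Let r > 0 and let g ∈ W^{1,2} of the upper semicircle γ = {(r cos θ, r sin θ) : θ ∈ [0, π]} satisfy g(r,0) = 0 and g(−r,0) = 0. Then there exists a function u, continuous on the closed upper half-disk {(ρ cos θ, ρ sin θ) : ρ ∈ [0,r], θ ∈ [0,π]}, harmonic in its interior, with u = g on γ, u(t,0) = 0 for all t ∈ [−r,r], and ∫ |∇u|² ≤ r·∫_γ (∂g/∂τ)² dℋ¹, where ∂g/∂τ denotes the tangential derivative of g along γ. -/

import Mathlib

open MeasureTheory Real

noncomputable section

abbrev E2 := EuclideanSpace ℝ (Fin 2)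

/-- `u` is harmonic on `s`: twice differentiable with vanishing Laplacian. -/
def IsHarmonicOn (u : E2 → ℝ) (s : Set E2) : Prop :=
  ContDiffOn ℝ 2 u s ∧ ∀ x ∈ s,
    (∑ i : Fin 2,
      fderiv ℝ (fun y => fderiv ℝ u y (EuclideanSpace.single i 1)) x
        (EuclideanSpace.single i 1)) = 0

/-- The point `(r cos θ, r sin θ)`. -/
def circlePt (r θ : ℝ) : E2 :=
  EuclideanSpace.single 0 (r * Real.cos θ) + EuclideanSpace.single 1 (r * Real.sin θ)


lemma int_cos_mul (m : ℝ) (hm : m ≠ 0) (h : Real.sin (m * π) = 0) :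
    ∫ θ in (0:ℝ)..π, Real.cos (m * θ) = 0 := by
  rw [intervalIntegral.integral_comp_mul_left (fun x => Real.cos x) hm]
  simp [h]

lemma int_cos_sub (k l : ℕ) :
    ∫ θ in (0:ℝ)..π, Real.cos (((k:ℝ) - l) * θ) = if k = l then π else 0 := by
  split_ifs with h
  · subst h; simp
  · apply int_cos_mul
    · rw [sub_ne_zero]; exact_mod_cast h
    · have := Real.sin_int_mul_pi ((k:ℤ) - l)
      push_cast at this; exact this

lemma int_cos_cos (k l : ℕ) :
    ∫ θ in (0:ℝ)..π, Real.cos (((k:ℝ)+1) * θ) * Real.cos (((l:ℝ)+1) * θ)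
      = if k = l then π / 2 else 0 := by
  have h : ∀ θ : ℝ, Real.cos (((k:ℝ)+1) * θ) * Real.cos (((l:ℝ)+1) * θ)
      = (1/2) * (Real.cos (((k:ℝ) - l) * θ) + Real.cos (((k:ℝ)+l+2) * θ)) := by
    intro θ
    have e1 : ((k:ℝ) - l) * θ = ((k:ℝ)+1) * θ - ((l:ℝ)+1) * θ := by ring
    have e2 : ((k:ℝ)+l+2) * θ = ((k:ℝ)+1) * θ + ((l:ℝ)+1) * θ := by ring
    rw [e1, e2, Real.cos_sub, Real.cos_add]; ring
  simp_rw [h]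
  rw [intervalIntegral.integral_const_mul, intervalIntegral.integral_add, int_cos_sub,
    int_cos_mul]
  · split_ifs <;> ring
  · positivity
  · have := Real.sin_nat_mul_pi (k + l + 2)
    push_cast at this; exact this
  · exact (by fun_prop : Continuous fun θ : ℝ => Real.cos (((k:ℝ) - l) * θ)).intervalIntegrable _ _
  · exact (by fun_prop : Continuous fun θ : ℝ =>
      Real.cos (((k:ℝ) + l + 2) * θ)).intervalIntegrable _ _

/-- Bessel's inequality for cosines on `[0, π]`. -/
lemma bessel_cos (p : ℝ → ℝ) (hp : IntervalIntegrable p volume 0 π)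
    (hp2 : IntervalIntegrable (fun θ => (p θ)^2) volume 0 π) (a : ℕ → ℝ)
    (ha : ∀ k : ℕ, ∫ θ in (0:ℝ)..π, p θ * Real.cos (((k:ℝ)+1) * θ) = π / 2 * a k) (N : ℕ) :
    π / 2 * ∑ k ∈ Finset.range N, (a k)^2 ≤ ∫ θ in (0:ℝ)..π, (p θ)^2 := by
  set S : ℝ → ℝ := fun θ => ∑ k ∈ Finset.range N, a k * Real.cos (((k:ℝ)+1) * θ) with hS
  have hSc : Continuous S := by fun_prop
  have hpS : IntervalIntegrable (fun θ => p θ * S θ) volume 0 π :=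
    hp.mul_continuousOn hSc.continuousOn
  have hSS : IntervalIntegrable (fun θ => S θ * S θ) volume 0 π :=
    (hSc.mul hSc).intervalIntegrable _ _
  have hpk : ∀ k : ℕ, IntervalIntegrable (fun θ => p θ * Real.cos (((k:ℝ)+1) * θ)) volume 0 π :=
    fun k => hp.mul_continuousOn (by fun_prop)
  have h1 : ∫ θ in (0:ℝ)..π, p θ * S θ = π / 2 * ∑ k ∈ Finset.range N, (a k)^2 := by
    have : ∀ θ, p θ * S θ = ∑ k ∈ Finset.range N, a k * (p θ * Real.cos (((k:ℝ)+1) * θ)) := by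
      intro θ; simp only [hS, Finset.mul_sum]; exact Finset.sum_congr rfl fun _ _ => by ring
    simp_rw [this]
    rw [intervalIntegral.integral_finsetSum (fun k _ => (hpk k).const_mul _), Finset.mul_sum]
    refine Finset.sum_congr rfl fun k _ => ?_
    rw [intervalIntegral.integral_const_mul, ha]; ring
  have h2 : ∫ θ in (0:ℝ)..π, S θ * S θ = π / 2 * ∑ k ∈ Finset.range N, (a k)^2 := by
    have : ∀ θ, S θ * S θ = ∑ k ∈ Finset.range N, ∑ l ∈ Finset.range N,
        (a k * a l) * (Real.cos (((k:ℝ)+1) * θ) * Real.cos (((l:ℝ)+1) * θ)) := by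
      intro θ; simp only [hS, Finset.sum_mul_sum]
      exact Finset.sum_congr rfl fun _ _ => Finset.sum_congr rfl fun _ _ => by ring
    simp_rw [this]
    rw [intervalIntegral.integral_finsetSum
      (fun k _ => (by fun_prop : Continuous _).intervalIntegrable _ _), Finset.mul_sum]
    refine Finset.sum_congr rfl fun k hk => ?_
    rw [intervalIntegral.integral_finsetSum
      (fun k _ => (by fun_prop : Continuous _).intervalIntegrable _ _)]
    simp_rw [intervalIntegral.integral_const_mul, int_cos_cos]
    simp [Finset.mem_range.mp hk]
    ring
  have h3 : 0 ≤ ∫ θ in (0:ℝ)..π, (p θ - S θ)^2 :=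
    intervalIntegral.integral_nonneg pi_pos.le fun _ _ => sq_nonneg _
  have h4 : ∫ θ in (0:ℝ)..π, (p θ - S θ)^2 = (∫ θ in (0:ℝ)..π, (p θ)^2)
      - 2 * (∫ θ in (0:ℝ)..π, p θ * S θ) + ∫ θ in (0:ℝ)..π, S θ * S θ := by
    have : ∀ θ, (p θ - S θ)^2 = (p θ)^2 - 2 * (p θ * S θ) + S θ * S θ := fun θ => by ring
    simp_rw [this]
    rw [intervalIntegral.integral_add (hp2.sub (hpS.const_mul 2)) hSS,
      intervalIntegral.integral_sub hp2 (hpS.const_mul 2), intervalIntegral.integral_const_mul]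
  rw [h4, h1, h2] at h3
  linarith

lemma deriv_integrable (g g' : ℝ → ℝ)
    (hg : ∀ θ ∈ Set.Icc (0 : ℝ) π, HasDerivAt g (g' θ) θ)
    (hg2 : IntervalIntegrable (fun θ => (g' θ) ^ 2) volume 0 π) :
    IntervalIntegrable g' volume 0 π := by
  rw [intervalIntegrable_iff_integrableOn_Icc_of_le pi_pos.le] at *
  have hm : AEStronglyMeasurable g' (volume.restrict (Set.Icc 0 π)) := by
    refine (stronglyMeasurable_deriv g).aestronglyMeasurable.congr ?_
    filter_upwards [ae_restrict_mem measurableSet_Icc] with x hx using (hg x hx).deriv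
  have : MemLp g' 2 (volume.restrict (Set.Icc 0 π)) := (memLp_two_iff_integrable_sq hm).2 hg2
  exact this.integrable (by norm_num)

lemma parts_coeff (g g' : ℝ → ℝ)
    (hg : ∀ θ ∈ Set.Icc (0 : ℝ) π, HasDerivAt g (g' θ) θ)
    (hi : IntervalIntegrable g' volume 0 π)
    (hg0 : g 0 = 0) (hgπ : g π = 0) (m : ℝ) :
    ∫ θ in (0:ℝ)..π, g' θ * Real.cos (m * θ) = m * ∫ θ in (0:ℝ)..π, g θ * Real.sin (m * θ) := by
  have h := intervalIntegral.integral_mul_deriv_eq_deriv_mul (a := 0) (b := π)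
    (u := fun θ => Real.cos (m * θ)) (u' := fun θ => - (m * Real.sin (m * θ))) (v := g) (v' := g')
    (fun x _ => by
      have h : HasDerivAt (fun θ : ℝ => Real.cos (m * θ)) (-Real.sin (m * x) * (m * 1)) x :=
        ((hasDerivAt_id' x).const_mul m).cos
      have e : -(m * Real.sin (m * x)) = -Real.sin (m * x) * (m * 1) := by ring
      rw [e]; exact h)
    (fun x hx => hg x (by rwa [Set.uIcc_of_le pi_pos.le] at hx))
    ((by fun_prop : Continuous fun θ : ℝ => - (m * Real.sin (m * θ))).intervalIntegrable _ _) hi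
  simp only [hg0, hgπ, mul_zero, sub_zero, zero_sub] at h
  rw [← intervalIntegral.integral_neg] at h
  rw [← intervalIntegral.integral_const_mul]
  calc _ = _ := intervalIntegral.integral_congr (fun θ _ => mul_comm _ _)
    _ = _ := h
    _ = _ := intervalIntegral.integral_congr (fun θ _ => by
      change -(-(m * Real.sin (m * θ)) * g θ) = m * (g θ * Real.sin (m * θ)); ring)

lemma summable_of_sq (b : ℕ → ℝ) (C : ℝ)
    (h : ∀ N : ℕ, ∑ k ∈ Finset.range N, (((k:ℝ)+1) * b k)^2 ≤ C) :
    Summable fun k => |b k| := by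
  have h1 : Summable fun k : ℕ => (((k:ℝ)+1) * b k)^2 :=
    summable_of_sum_range_le (fun _ => sq_nonneg _) h
  have h2 : Summable fun k : ℕ => 1 / ((k:ℝ)+1)^2 := by
    have := (summable_nat_add_iff 1).2 (Real.summable_one_div_nat_pow.2 (by norm_num : 1 < 2))
    simpa using this
  refine Summable.of_nonneg_of_le (fun _ => abs_nonneg _) (fun k => ?_) (h1.add h2)
  have hk : (0:ℝ) < (k:ℝ) + 1 := by positivity
  have e : |b k| = |((k:ℝ)+1) * b k| * (1 / ((k:ℝ)+1)) := by
    rw [abs_mul, abs_of_pos hk]; field_simp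
  have e2 : 1 / ((k:ℝ)+1)^2 = (1 / ((k:ℝ)+1))^2 := by rw [div_pow, one_pow]
  rw [e, e2, ← sq_abs (((k:ℝ)+1) * b k)]
  nlinarith [sq_nonneg (|((k:ℝ)+1) * b k| - 1 / ((k:ℝ)+1)), sq_nonneg (|((k:ℝ)+1) * b k|), sq_nonneg (1 / ((k:ℝ)+1))]

lemma fourier_sum (g : ℝ → ℝ) (hc : ContinuousOn g (Set.Icc 0 π)) (hg0 : g 0 = 0) (hgπ : g π = 0)
    (b : ℕ → ℝ) (hb : ∀ k : ℕ, b k = 2 / π * ∫ θ in (0:ℝ)..π, g θ * Real.sin (((k:ℝ)+1) * θ))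
    (hs : Summable fun k => |b k|) (θ : ℝ) (hθ : θ ∈ Set.Icc (0:ℝ) π) :
    HasSum (fun k : ℕ => b k * Real.sin (((k:ℝ)+1) * θ)) (g θ) := by
  rcases eq_or_lt_of_le hθ.2 with h | hlt
  · subst h
    have : ∀ k : ℕ, b k * Real.sin (((k:ℝ)+1) * π) = 0 := fun k => by
      have := Real.sin_nat_mul_pi (k+1)
      push_cast at this; rw [this, mul_zero]
    simp_rw [this, hgπ]; exact hasSum_zero
  have hT : Fact (0 < 2 * π) := ⟨by positivity⟩
  set G : ℝ → ℂ := fun x => ((g (max x 0) - g (max (-x) 0) : ℝ) : ℂ) with hG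
  have hGc : ContinuousOn G (Set.Icc (-π) (-π + 2*π)) := by
    apply Complex.continuous_ofReal.comp_continuousOn
    apply ContinuousOn.sub
    · refine hc.comp (by fun_prop) fun x hx => ⟨le_max_right _ _, max_le ?_ pi_pos.le⟩
      linarith [hx.2]
    · refine hc.comp (by fun_prop) fun x hx => ⟨le_max_right _ _, max_le ?_ pi_pos.le⟩
      linarith [hx.1]
  have hGper : G (-π) = G (-π + 2*π) := by
    have : -π + 2*π = π := by ring
    rw [this]
    simp [hG, max_eq_left pi_pos.le, max_eq_right (neg_nonpos.2 pi_pos.le), hg0, hgπ]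
  let F : C(AddCircle (2*π), ℂ) :=
    ⟨AddCircle.liftIco (2*π) (-π) G, AddCircle.liftIco_continuous hGper hGc⟩
  set B : ℤ → ℝ := fun n => 2 / π * ∫ θ in (0:ℝ)..π, g θ * Real.sin ((n:ℝ) * θ) with hB
  have hBneg : ∀ n, B (-n) = - B n := by
    intro n; simp only [hB]
    push_cast
    simp only [neg_mul, Real.sin_neg, mul_neg, intervalIntegral.integral_neg]
  have hB0 : B 0 = 0 := by simp [hB]
  have hBs : ∀ k : ℕ, B ((k+1 : ℕ) : ℤ) = b k := by
    intro k; rw [hb]; simp [hB]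
  have hcoef : ∀ n, fourierCoeff F n = -(Complex.I / 2) * B n := by
    intro n
    change fourierCoeff (AddCircle.liftIco (2*π) (-π) G) n = _
    rw [fourierCoeff_liftIco_eq, fourierCoeffOn_eq_integral]
    have e : ∀ (n : ℤ) (x : ℝ), fourier n (x : AddCircle (-π + 2*π - -π))
        = Complex.exp (Complex.I * n * x) := by
      intro n x
      rw [fourier_coe_apply]; congr 1; push_cast
      have : (π:ℂ) ≠ 0 := by exact_mod_cast pi_ne_zero
      have h2 : (-(π:ℂ) + 2 * π - -π) = 2 * π := by ring
      rw [h2]; field_simp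
    simp_rw [e]
    have e2 : -π + 2*π = π := by ring
    have hGc' : ContinuousOn G (Set.Icc (-π) π) := by rwa [e2] at hGc
    have hgi : ∀ m : ℂ, IntervalIntegrable (fun x : ℝ => Complex.exp (m * x) * (g x : ℂ))
        volume 0 π := by
      intro m
      apply ContinuousOn.intervalIntegrable
      rw [Set.uIcc_of_le pi_pos.le]
      exact ContinuousOn.mul (by fun_prop) (Complex.continuous_ofReal.comp_continuousOn hc)
    have hi : IntervalIntegrable (fun x : ℝ => Complex.exp (Complex.I * (-n : ℤ) * x) • G x)
        volume (-π) π := by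
      apply ContinuousOn.intervalIntegrable
      rw [Set.uIcc_of_le (by linarith [pi_pos])]
      have hE : Continuous fun x : ℝ => Complex.exp (Complex.I * (-n : ℤ) * x) := by fun_prop
      exact hE.continuousOn.smul hGc'
    have m0 : (0:ℝ) ∈ Set.uIcc (-π) π := by
      rw [Set.uIcc_of_le (by linarith [pi_pos])]; exact ⟨by linarith [pi_pos], pi_pos.le⟩
    have i1 := hi.mono_set (Set.uIcc_subset_uIcc_left m0)
    have i2 := hi.mono_set (Set.uIcc_subset_uIcc_right m0)
    rw [show -π + 2*π - -π = 2 * π by ring, e2,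
      ← intervalIntegral.integral_add_adjacent_intervals i1 i2]
    have l1 : ∫ x in (-π)..0, Complex.exp (Complex.I * (-n : ℤ) * x) • G x
        = - ∫ x in (0:ℝ)..π, Complex.exp (Complex.I * n * x) * (g x : ℂ) := by
      rw [← neg_zero, ← intervalIntegral.integral_comp_neg, neg_zero,
        ← intervalIntegral.integral_neg]
      apply intervalIntegral.integral_congr
      intro x hx
      rw [Set.uIcc_of_le pi_pos.le] at hx
      simp [hG, max_eq_left hx.1, max_eq_right (neg_nonpos.2 hx.1), hg0]
    have l2 : ∫ x in (0:ℝ)..π, Complex.exp (Complex.I * (-n : ℤ) * x) • G x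
        = ∫ x in (0:ℝ)..π, Complex.exp (-(Complex.I * n) * x) * (g x : ℂ) := by
      apply intervalIntegral.integral_congr
      intro x hx
      rw [Set.uIcc_of_le pi_pos.le] at hx
      simp [hG, max_eq_left hx.1, max_eq_right (neg_nonpos.2 hx.1), hg0]
    rw [l1, l2, neg_add_eq_sub, ← intervalIntegral.integral_sub (hgi _) (hgi _)]
    have l3 : ∀ x : ℝ, Complex.exp (-(Complex.I * n) * x) * (g x : ℂ)
        - Complex.exp (Complex.I * n * x) * (g x : ℂ)
        = (-2 * Complex.I) * ((g x * Real.sin ((n:ℝ) * x) : ℝ) : ℂ) := by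
      intro x
      push_cast
      rw [Complex.sin]
      have : (-2 * Complex.I) * ((g x : ℂ) * ((Complex.exp (-(n * x) * Complex.I)
         - Complex.exp (n * x * Complex.I)) * Complex.I / 2))
         = - (Complex.I * Complex.I) * ((Complex.exp (-(n * x) * Complex.I)
         - Complex.exp (n * x * Complex.I)) * g x) := by ring
      rw [this, Complex.I_mul_I, neg_neg, one_mul, sub_mul]
      ring_nf
    simp_rw [l3]
    rw [intervalIntegral.integral_const_mul, intervalIntegral.integral_ofReal]
    simp only [hB]
    rw [Complex.real_smul]
    push_cast
    have : (π:ℂ) ≠ 0 := by exact_mod_cast pi_ne_zero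
    field_simp
  have hsB : Summable fun n : ℤ => |B n| := by
    have hN : Summable fun n : ℕ => |B n| := by
      rw [← summable_nat_add_iff 1]
      simpa only [hBs] using hs
    refine Summable.of_nat_of_neg hN ?_
    simpa only [hBneg, abs_neg] using hN
  have hsum : Summable (fourierCoeff F) := by
    apply Summable.of_norm
    simp_rw [hcoef]
    simp only [norm_mul, Complex.norm_real, Real.norm_eq_abs]
    exact hsB.mul_left _
  have key := (has_pointwise_sum_fourier_series_of_summable hsum (θ : AddCircle (2*π))).nat_add_neg
  have hF : F (θ : AddCircle (2*π)) = g θ := by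
    change AddCircle.liftIco (2*π) (-π) G _ = _
    rw [AddCircle.liftIco_coe_apply ⟨by linarith [hθ.1, pi_pos], by linarith⟩]
    simp [hG, max_eq_left hθ.1, max_eq_right (neg_nonpos.2 hθ.1), hg0]
  rw [hF, hcoef 0, hB0] at key
  simp only [Complex.ofReal_zero, mul_zero, zero_smul, add_zero] at key
  have e3 : ∀ n : ℕ, fourierCoeff F n • fourier (n:ℤ) (θ : AddCircle (2*π))
      + fourierCoeff F (-n) • fourier (-(n:ℤ)) (θ : AddCircle (2*π))
      = ((B n * Real.sin (n * θ) : ℝ) : ℂ) := by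
    intro n
    rw [hcoef, hcoef, hBneg, fourier_coe_apply, fourier_coe_apply]
    have : (π:ℂ) ≠ 0 := by exact_mod_cast pi_ne_zero
    have t1 : 2 * π * Complex.I * (n:ℤ) * θ / ((2 * π : ℝ):ℂ) = n * θ * Complex.I := by
      push_cast; field_simp
    have t2 : 2 * π * Complex.I * (-(n:ℤ) : ℤ) * θ / ((2 * π : ℝ):ℂ) = -(n * θ) * Complex.I := by
      push_cast; field_simp
    rw [t1, t2]
    push_cast
    rw [Complex.sin, smul_eq_mul, smul_eq_mul]
    ring
  simp_rw [e3] at key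
  rw [Complex.hasSum_ofReal] at key
  have key2 := (hasSum_nat_add_iff' (f := fun n : ℕ => B n * Real.sin (n * θ)) 1).2 key
  simp only [Finset.range_one, Finset.sum_singleton, Nat.cast_zero, zero_mul, Real.sin_zero,
    mul_zero, sub_zero, hBs] at key2
  simpa using key2

/-- The open upper half-disk in `ℂ`. -/
def halfDisk (r : ℝ) : Set ℂ := {z | ‖z‖ < r ∧ 0 < z.im}

lemma halfDisk_open (r : ℝ) : IsOpen (halfDisk r) :=
  (isOpen_lt continuous_norm continuous_const).inter
    (isOpen_lt continuous_const Complex.continuous_im)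

lemma normSq_poly_polar (c : ℕ → ℝ) (N : ℕ) (ρ θ : ℝ) :
    Complex.normSq (∑ k ∈ Finset.range N, (c k : ℂ) *
      ((ρ : ℂ) * (Real.cos θ + Real.sin θ * Complex.I))^k)
    = ∑ k ∈ Finset.range N, ∑ l ∈ Finset.range N,
      (c k * c l * ρ^(k+l)) * Real.cos (((k:ℝ) - l) * θ) := by
  have h : ∀ k : ℕ, (c k : ℂ) * ((ρ : ℂ) * (Real.cos θ + Real.sin θ * Complex.I))^k
      = ((c k * ρ^k * Real.cos (k * θ) : ℝ) : ℂ)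
        + ((c k * ρ^k * Real.sin (k * θ) : ℝ) : ℂ) * Complex.I := by
    intro k
    push_cast
    rw [mul_pow, Complex.cos_add_sin_mul_I_pow]
    ring
  simp_rw [h]
  rw [Finset.sum_add_distrib, ← Finset.sum_mul, ← Complex.ofReal_sum, ← Complex.ofReal_sum,
    Complex.normSq_add_mul_I, sq, sq, Finset.sum_mul_sum, Finset.sum_mul_sum,
    ← Finset.sum_add_distrib]
  refine Finset.sum_congr rfl fun k _ => ?_
  rw [← Finset.sum_add_distrib]
  refine Finset.sum_congr rfl fun l _ => ?_
  rw [sub_mul, Real.cos_sub, pow_add]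
  ring

lemma integral_halfDisk_polar (r : ℝ) (φ : ℂ → ℝ) :
    ∫ z in halfDisk r, φ z = ∫ p in Set.Ioo (0:ℝ) r ×ˢ Set.Ioo (0:ℝ) π,
      p.1 * φ ((p.1 : ℂ) * (Real.cos p.2 + Real.sin p.2 * Complex.I)) := by
  rw [← integral_indicator (halfDisk_open r).measurableSet,
    ← Complex.integral_comp_polarCoord_symm]
  have hD : MeasurableSet (Set.Ioo (0:ℝ) r ×ˢ Set.Ioo (0:ℝ) π) :=
    measurableSet_Ioo.prod measurableSet_Ioo
  have hT : MeasurableSet polarCoord.target := polarCoord.open_target.measurableSet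
  have hsub : polarCoord.target ∩ (Set.Ioo (0:ℝ) r ×ˢ Set.Ioo (0:ℝ) π)
      = Set.Ioo (0:ℝ) r ×ˢ Set.Ioo (0:ℝ) π := by
    apply Set.inter_eq_right.2
    rintro ⟨a, b⟩ ⟨ha, hb⟩
    exact ⟨ha.1, by linarith [hb.1, pi_pos], hb.2⟩
  have e : ∫ p in Set.Ioo (0:ℝ) r ×ˢ Set.Ioo (0:ℝ) π,
      p.1 * φ ((p.1 : ℂ) * (Real.cos p.2 + Real.sin p.2 * Complex.I))
      = ∫ p in polarCoord.target, (Set.Ioo (0:ℝ) r ×ˢ Set.Ioo (0:ℝ) π).indicator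
        (fun p => p.1 * φ ((p.1 : ℂ) * (Real.cos p.2 + Real.sin p.2 * Complex.I))) p := by
    rw [setIntegral_indicator hD, hsub]
  rw [e]
  refine setIntegral_congr_fun hT ?_
  rintro ⟨a, b⟩ ⟨ha, hb⟩
  have ha : 0 < a := ha
  have hb1 : -π < b := hb.1
  have hb2 : b < π := hb.2
  have hmem : (a : ℂ) * (Real.cos b + Real.sin b * Complex.I) ∈ halfDisk r
      ↔ (a, b) ∈ Set.Ioo (0:ℝ) r ×ˢ Set.Ioo (0:ℝ) π := by
    have hn : ‖(a : ℂ) * (Real.cos b + Real.sin b * Complex.I)‖ = a := by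
      have := Complex.norm_polarCoord_symm (a, b)
      rw [Complex.polarCoord_symm_apply] at this
      rw [this, abs_of_pos ha]
    have him : ((a : ℂ) * (Real.cos b + Real.sin b * Complex.I)).im = a * Real.sin b := by
      simp [-Complex.ofReal_cos, -Complex.ofReal_sin]
    simp only [halfDisk, Set.mem_ofPred_eq, hn, him, Set.mem_prod, Set.mem_Ioo]
    constructor
    · rintro ⟨h1, h2⟩
      refine ⟨⟨ha, h1⟩, ?_, hb2⟩
      by_contra hle
      have := Real.sin_nonpos_of_nonpos_of_neg_pi_le (not_lt.1 hle) hb1.le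
      nlinarith
    · rintro ⟨h1, h2⟩
      exact ⟨h1.2, mul_pos ha (Real.sin_pos_of_pos_of_lt_pi h2.1 h2.2)⟩
  simp only [Complex.polarCoord_symm_apply, smul_eq_mul]
  by_cases h : (a, b) ∈ Set.Ioo (0:ℝ) r ×ˢ Set.Ioo (0:ℝ) π
  · rw [Set.indicator_of_mem h, Set.indicator_of_mem (hmem.2 h)]
  · rw [Set.indicator_of_notMem h, Set.indicator_of_notMem (fun h' => h (hmem.1 h')), mul_zero]

lemma poly_energy (r : ℝ) (hr : 0 < r) (c : ℕ → ℝ) (N : ℕ) :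
    ∫ z in halfDisk r, Complex.normSq (∑ k ∈ Finset.range N, (c k : ℂ) * z^k)
      = ∑ k ∈ Finset.range N, π * ((c k)^2 * (r^(2*k+2) / (2*k+2))) := by
  rw [integral_halfDisk_polar]
  simp_rw [normSq_poly_polar]
  have hcont : Continuous fun p : ℝ × ℝ => p.1 * ∑ k ∈ Finset.range N, ∑ l ∈ Finset.range N,
      (c k * c l * p.1^(k+l)) * Real.cos (((k:ℝ) - l) * p.2) := by fun_prop
  have hint : IntegrableOn (fun p : ℝ × ℝ => p.1 * ∑ k ∈ Finset.range N, ∑ l ∈ Finset.range N,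
      (c k * c l * p.1^(k+l)) * Real.cos (((k:ℝ) - l) * p.2))
      (Set.Ioo (0:ℝ) r ×ˢ Set.Ioo (0:ℝ) π) (volume.prod volume) := by
    refine IntegrableOn.mono_set (hcont.continuousOn.integrableOn_compact
      ((isCompact_Icc (a := (0:ℝ)) (b := r)).prod (isCompact_Icc (a := (0:ℝ)) (b := π)))) ?_
    exact Set.prod_mono Set.Ioo_subset_Icc_self Set.Ioo_subset_Icc_self
  rw [Measure.volume_eq_prod, setIntegral_prod _ hint]
  have inner : ∀ x : ℝ, ∫ y in Set.Ioo (0:ℝ) π, x * ∑ k ∈ Finset.range N, ∑ l ∈ Finset.range N,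
      (c k * c l * x^(k+l)) * Real.cos (((k:ℝ) - l) * y)
      = ∑ k ∈ Finset.range N, (π * (c k)^2) * x^(2*k+1) := by
    intro x
    rw [← integral_Ioc_eq_integral_Ioo, ← intervalIntegral.integral_of_le pi_pos.le,
      intervalIntegral.integral_const_mul, intervalIntegral.integral_finsetSum
      (fun k _ => (by fun_prop : Continuous _).intervalIntegrable _ _), Finset.mul_sum]
    refine Finset.sum_congr rfl fun k hk => ?_
    rw [intervalIntegral.integral_finsetSum
      (fun k _ => (by fun_prop : Continuous _).intervalIntegrable _ _)]
    simp_rw [intervalIntegral.integral_const_mul, int_cos_sub]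
    simp only [mul_ite, mul_zero, Finset.sum_ite_eq, hk, if_true]
    ring
  simp_rw [inner]
  rw [← integral_Ioc_eq_integral_Ioo, ← intervalIntegral.integral_of_le hr.le,
      intervalIntegral.integral_finsetSum
      (fun k _ => (by fun_prop : Continuous _).intervalIntegrable _ _)]
  refine Finset.sum_congr rfl fun k hk => ?_
  rw [intervalIntegral.integral_const_mul, integral_pow]
  push_cast
  simp
  ring

lemma energy_bound (r : ℝ) (hr : 0 < r) (β : ℕ → ℝ) (C : ℝ)
    (hC : ∀ N : ℕ, π / 2 * ∑ k ∈ Finset.range N, (((k:ℝ)+1) * β k)^2 ≤ C) (D : ℂ → ℂ)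
    (hD : ∀ z : ℂ, ‖z‖ < r → HasSum
      (fun k : ℕ => ((β k * (k+1) / r^(k+1) : ℝ) : ℂ) * z^k) (D z)) :
    ∫⁻ z in halfDisk r, ENNReal.ofReal (Complex.normSq (D z)) ≤ ENNReal.ofReal C := by
  set c : ℕ → ℝ := fun k => β k * (k+1) / r^(k+1) with hc
  set P : ℕ → ℂ → ℂ := fun N z => ∑ k ∈ Finset.range N, (c k : ℂ) * z^k with hP
  have hPc : ∀ N, Continuous fun z => Complex.normSq (P N z) := fun N =>
    Complex.continuous_normSq.comp (by fun_prop)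
  have hlim : ∀ z ∈ halfDisk r, ENNReal.ofReal (Complex.normSq (D z))
      = Filter.liminf (fun N => ENNReal.ofReal (Complex.normSq (P N z))) Filter.atTop := by
    intro z hz
    refine (Filter.Tendsto.liminf_eq ?_).symm
    refine (ENNReal.continuous_ofReal.tendsto _).comp ?_
    exact (Complex.continuous_normSq.tendsto _).comp (hD z hz.1).tendsto_sum_nat
  rw [setLIntegral_congr_fun (halfDisk_open r).measurableSet hlim]
  refine (lintegral_liminf_le fun N => (hPc N).measurable.ennreal_ofReal).trans ?_
  have hN : ∀ N, ∫⁻ z in halfDisk r, ENNReal.ofReal (Complex.normSq (P N z))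
      ≤ ENNReal.ofReal C := by
    intro N
    have hint : IntegrableOn (fun z => Complex.normSq (P N z)) (halfDisk r) := by
      refine ((hPc N).continuousOn.integrableOn_compact
        (isCompact_closedBall (0:ℂ) r)).mono_set ?_
      intro z hz
      simpa using hz.1.le
    rw [← ofReal_integral_eq_lintegral_ofReal hint
      (Filter.Eventually.of_forall fun z => Complex.normSq_nonneg _)]
    apply ENNReal.ofReal_le_ofReal
    refine le_trans ?_ (hC N)
    rw [poly_energy r hr c N, Finset.mul_sum]
    refine Finset.sum_le_sum fun k _ => ?_
    have hk : (0:ℝ) < (k:ℝ) + 1 := by positivity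
    have e : π * ((c k)^2 * (r^(2*k+2) / (2*k+2))) = π / 2 * ((k+1) * (β k)^2) := by
      simp only [hc]
      have : r^(2*k+2) = (r^(k+1))^2 := by ring
      rw [this]
      field_simp
    rw [e]
    have : ((k:ℝ)+1) * (β k)^2 ≤ (((k:ℝ)+1) * β k)^2 := by
      have : (0:ℝ) ≤ k := by positivity
      nlinarith [sq_nonneg (β k), mul_nonneg this (sq_nonneg (β k)), mul_nonneg (mul_nonneg this this) (sq_nonneg (β k))]
    gcongr
  exact Filter.liminf_le_of_le (by isBoundedDefault) (fun b hb => by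
    obtain ⟨n, hn⟩ := hb.exists
    exact hn.trans (hN n))

/-- The isometric identification of the plane with `ℂ`. -/
def toC : E2 ≃ₗᵢ[ℝ] ℂ := Complex.orthonormalBasisOneI.repr.symm

lemma toC_apply (x : E2) : toC x = x 0 + x 1 * Complex.I :=
  Complex.orthonormalBasisOneI_repr_symm_apply x

lemma toC_e0 : toC (EuclideanSpace.single 0 1) = 1 := by simp [toC_apply]

lemma toC_e1 : toC (EuclideanSpace.single 1 1) = Complex.I := by simp [toC_apply]

/-- Chain rule: real-linear functional of a holomorphic function. -/
lemma hasFDerivAt_comp_toC (φ : ℂ →L[ℝ] ℝ) (f : ℂ → ℂ) (f' : ℂ) (x : E2)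
    (hf : HasDerivAt f f' (toC x)) (v : E2) :
    fderiv ℝ (fun y => φ (f (toC y))) x v = φ (f' * toC v) := by
  have h1 : HasFDerivAt f ((ContinuousLinearMap.toSpanSingleton ℂ f').restrictScalars ℝ)
      (toC x) := hf.hasFDerivAt.restrictScalars ℝ
  have h2 : HasFDerivAt (fun y : E2 => toC y) (toC.toContinuousLinearEquiv : E2 →L[ℝ] ℂ) x :=
    toC.toContinuousLinearEquiv.hasFDerivAt
  have h3 : HasFDerivAt (fun y : E2 => f (toC y))
      (((ContinuousLinearMap.toSpanSingleton ℂ f').restrictScalars ℝ).comp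
        (toC.toContinuousLinearEquiv : E2 →L[ℝ] ℂ)) x := HasFDerivAt.comp x h1 h2
  have h4 := φ.hasFDerivAt.comp x h3
  have h5 := h4.fderiv
  change fderiv ℝ (fun y => φ (f (toC y))) x = _ at h5
  rw [h5]
  simp [mul_comm]

lemma im_harmonic (r : ℝ) (f : ℂ → ℂ) (hf : DifferentiableOn ℂ f (Metric.ball 0 r)) (s : Set E2)
    (hs : ∀ x ∈ s, toC x ∈ Metric.ball (0:ℂ) r) :
    IsHarmonicOn (fun x => (f (toC x)).im) s := by
  have hop : IsOpen (Metric.ball (0:ℂ) r) := Metric.isOpen_ball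
  have hd : ∀ z ∈ Metric.ball (0:ℂ) r, HasDerivAt f (deriv f z) z := fun z hz =>
    (hf.differentiableAt (hop.mem_nhds hz)).hasDerivAt
  have hd2 : ∀ z ∈ Metric.ball (0:ℂ) r, HasDerivAt (deriv f) (deriv (deriv f) z) z := fun z hz =>
    ((hf.deriv hop).differentiableAt (hop.mem_nhds hz)).hasDerivAt
  constructor
  · have h1 : ContDiffOn ℂ 2 f (Metric.ball 0 r) := hf.contDiffOn hop
    have h2 : ContDiffOn ℝ 2 f (Metric.ball 0 r) := h1.restrict_scalars ℝ
    have h3 : ContDiff ℝ 2 (fun x : E2 => toC x) := toC.toContinuousLinearEquiv.contDiff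
    have h4 : ContDiff ℝ 2 (fun z : ℂ => z.im) := Complex.imCLM.contDiff
    exact h4.comp_contDiffOn (h2.comp h3.contDiffOn hs)
  · intro x hx
    have hn : ∀ᶠ y in nhds x, toC y ∈ Metric.ball (0:ℂ) r :=
      toC.continuous.continuousAt.eventually (hop.mem_nhds (hs x hx))
    have e0 : (fun y => fderiv ℝ (fun x => (f (toC x)).im) y (EuclideanSpace.single 0 1))
        =ᶠ[nhds x] fun y => Complex.imCLM (deriv f (toC y)) := by
      filter_upwards [hn] with y hy
      have := hasFDerivAt_comp_toC Complex.imCLM f _ y (hd _ hy) (EuclideanSpace.single 0 1)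
      rw [toC_e0, mul_one] at this
      exact this
    have e1 : (fun y => fderiv ℝ (fun x => (f (toC x)).im) y (EuclideanSpace.single 1 1))
        =ᶠ[nhds x] fun y => Complex.reCLM (deriv f (toC y)) := by
      filter_upwards [hn] with y hy
      have := hasFDerivAt_comp_toC Complex.imCLM f _ y (hd _ hy) (EuclideanSpace.single 1 1)
      rw [toC_e1] at this
      refine Eq.trans this ?_
      simp
    rw [Fin.sum_univ_two, e0.fderiv_eq, e1.fderiv_eq,
      hasFDerivAt_comp_toC Complex.imCLM _ _ x (hd2 _ (hs x hx)),
      hasFDerivAt_comp_toC Complex.reCLM _ _ x (hd2 _ (hs x hx)), toC_e0, toC_e1]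
    simp

lemma grad_im (f : ℂ → ℂ) (x : E2) (hf : HasDerivAt f (deriv f (toC x)) (toC x)) :
    ∑ i : Fin 2, (fderiv ℝ (fun x => (f (toC x)).im) x (EuclideanSpace.single i 1)) ^ 2
      = Complex.normSq (deriv f (toC x)) := by
  have h := hasFDerivAt_comp_toC Complex.imCLM f _ x hf
  simp only [Complex.imCLM_apply] at h
  rw [Fin.sum_univ_two, h, h, toC_e0, toC_e1, Complex.normSq_apply]
  simp
  ring

/-- Harmonic extension on the half-disk with zero boundary values on the diameter.
The boundary datum on the semicircle is given in the angular variable by `g`, with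
tangential derivative `g' θ / r`, so that `r·∫_γ (∂g/∂τ)² dℋ¹ = ∫₀^π g'(θ)² dθ`. -/
theorem harmonic_extension_halfdisk (r : ℝ) (hr : 0 < r) (g g' : ℝ → ℝ)
    (hg : ∀ θ ∈ Set.Icc (0 : ℝ) π, HasDerivAt g (g' θ) θ)
    (hg2 : IntervalIntegrable (fun θ => (g' θ) ^ 2) volume 0 π)
    (hg0 : g 0 = 0) (hgπ : g π = 0) :
    ∃ u : E2 → ℝ,
      ContinuousOn u (Metric.closedBall (0 : E2) r ∩ {x : E2 | 0 ≤ x 1}) ∧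
      IsHarmonicOn u (Metric.ball (0 : E2) r ∩ {x : E2 | 0 < x 1}) ∧
      (∀ θ ∈ Set.Icc (0 : ℝ) π, u (circlePt r θ) = g θ) ∧
      (∀ t ∈ Set.Icc (-r) r, u (EuclideanSpace.single 0 t) = 0) ∧
      (∫ x in Metric.ball (0 : E2) r ∩ {x : E2 | 0 < x 1},
          ∑ i : Fin 2, (fderiv ℝ u x (EuclideanSpace.single i 1)) ^ 2)
        ≤ ∫ θ in (0 : ℝ)..π, (g' θ) ^ 2 := by
  have hi := deriv_integrable g g' hg hg2
  have hc : ContinuousOn g (Set.Icc 0 π) := fun x hx => (hg x hx).continuousAt.continuousWithinAt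
  set b : ℕ → ℝ := fun k => 2 / π * ∫ θ in (0:ℝ)..π, g θ * Real.sin (((k:ℝ)+1) * θ) with hb
  set C := ∫ θ in (0 : ℝ)..π, (g' θ) ^ 2 with hCdef
  have hC0 : 0 ≤ C := intervalIntegral.integral_nonneg pi_pos.le fun _ _ => sq_nonneg _
  have hC : ∀ N : ℕ, π / 2 * ∑ k ∈ Finset.range N, (((k:ℝ)+1) * b k)^2 ≤ C := by
    refine bessel_cos g' hi hg2 (fun k => ((k:ℝ)+1) * b k) fun k => ?_
    rw [parts_coeff g g' hg hi hg0 hgπ]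
    simp only [hb]
    field_simp
  have hs : Summable fun k => |b k| := by
    refine summable_of_sq b (C / (π / 2)) fun N => ?_
    rw [le_div_iff₀ (by positivity), mul_comm]
    exact hC N
  have hfs := fourier_sum g hc hg0 hgπ b (fun _ => rfl) hs
  have hrC : (r:ℂ) ≠ 0 := by exact_mod_cast hr.ne'
  set T : ℕ → ℂ → ℂ := fun k z => (b k : ℂ) * (z / r)^(k+1) with hT
  set f : ℂ → ℂ := fun z => ∑' k, T k z with hf
  have hTd : ∀ k, Differentiable ℂ (T k) := fun k => by
    simp only [hT]; fun_prop
  have hTb : ∀ k (z : ℂ), ‖z‖ ≤ r → ‖T k z‖ ≤ |b k| := by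
    intro k z hz
    simp only [hT, norm_mul, norm_pow, norm_div, Complex.norm_real, Real.norm_eq_abs,
      abs_of_pos hr]
    refine mul_le_of_le_one_right (abs_nonneg _) (pow_le_one₀ (by positivity) ?_)
    rwa [div_le_one hr]
  have hTs : ∀ z : ℂ, ‖z‖ ≤ r → Summable fun k => T k z := fun z hz =>
    Summable.of_norm_bounded hs fun k => hTb k z hz
  have hfim : ∀ z : ℂ, ‖z‖ ≤ r → HasSum (fun k => (T k z).im) (f z).im := fun z hz =>
    Complex.hasSum_im (hTs z hz).hasSum
  have hfc : ContinuousOn f (Metric.closedBall 0 r) :=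
    continuousOn_tsum (fun k => (hTd k).continuous.continuousOn) hs
      fun k z hz => hTb k z (by simpa using hz)
  have hball : ∀ k, ∀ z ∈ Metric.ball (0:ℂ) r, ‖T k z‖ ≤ |b k| := fun k z hz =>
    hTb k z (by simpa using (Metric.ball_subset_closedBall hz))
  have hfd : DifferentiableOn ℂ f (Metric.ball 0 r) :=
    Complex.differentiableOn_tsum_of_summable_norm hs (fun k => (hTd k).differentiableOn)
      Metric.isOpen_ball hball
  have hD : ∀ z : ℂ, ‖z‖ < r → HasSum
      (fun k : ℕ => ((b k * (k+1) / r^(k+1) : ℝ) : ℂ) * z^k) (deriv f z) := by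
    intro z hz
    have h := Complex.hasSum_deriv_of_summable_norm hs (fun k => (hTd k).differentiableOn)
      Metric.isOpen_ball hball (by simpa using hz : z ∈ Metric.ball (0:ℂ) r)
    have e : ∀ k : ℕ, deriv (T k) z = ((b k * (k+1) / r^(k+1) : ℝ) : ℂ) * z^k := by
      intro k
      have h1 : HasDerivAt (fun z : ℂ => (b k : ℂ) * (z / r)^(k+1))
          ((b k : ℂ) * (((k+1 : ℕ) : ℂ) * (z / r)^k * (1 / r))) z :=
        (((hasDerivAt_id' z).div_const (r:ℂ)).pow (k+1)).const_mul (b k : ℂ)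
      rw [h1.deriv]
      push_cast
      rw [div_pow]
      field_simp
      ring
    simp_rw [e] at h
    exact h
  have hnorm : ∀ x : E2, ‖toC x‖ = ‖x‖ := fun x => toC.norm_map x
  have himx : ∀ x : E2, (toC x).im = x 1 := fun x => by simp [toC_apply]
  refine ⟨fun x => (f (toC x)).im, ?_, ?_, ?_, ?_, ?_⟩
  · refine Complex.continuous_im.comp_continuousOn (hfc.comp toC.continuous.continuousOn ?_)
    intro x hx
    have := hx.1
    simpa [hnorm] using this
  · refine im_harmonic r f hfd _ fun x hx => ?_
    have := hx.1
    simpa [hnorm] using this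
  · intro θ hθ
    have hz : toC (circlePt r θ) = r * (Complex.cos θ + Complex.sin θ * Complex.I) := by
      simp [toC_apply, circlePt]; ring
    have hn : ‖toC (circlePt r θ)‖ ≤ r := by
      have := Complex.norm_polarCoord_symm (r, θ)
      rw [Complex.polarCoord_symm_apply] at this
      push_cast at this
      rw [hz, this, abs_of_pos hr]
    refine (hfim _ hn).unique ?_
    convert hfs θ hθ using 2 with k
    simp only [hT]
    rw [hz, mul_div_cancel_left₀ _ hrC, Complex.cos_add_sin_mul_I_pow]
    have : (((k+1 : ℕ) : ℂ) * θ) = ((((k:ℝ)+1) * θ : ℝ) : ℂ) := by push_cast; ring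
    rw [this, ← Complex.ofReal_cos, ← Complex.ofReal_sin]
    simp only [Complex.re_ofReal_mul, Complex.im_ofReal_mul, Complex.add_im, Complex.ofReal_im,
      Complex.I_im, mul_one, zero_add]
  · intro t ht
    have hz : toC (EuclideanSpace.single 0 t) = (t:ℂ) := by simp [toC_apply]
    have hn : ‖toC (EuclideanSpace.single 0 t)‖ ≤ r := by
      rw [hz, Complex.norm_real, Real.norm_eq_abs]; exact abs_le.2 ht
    refine (hfim _ hn).unique ?_
    convert hasSum_zero using 2 with k
    simp only [hT]
    rw [hz]
    have : (b k : ℂ) * ((t:ℂ) / r)^(k+1) = ((b k * (t / r)^(k+1) : ℝ) : ℂ) := by push_cast; ring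
    rw [this, Complex.ofReal_im]
  · have hset : Metric.ball (0 : E2) r ∩ {x : E2 | 0 < x 1} = toC ⁻¹' (halfDisk r) := by
      ext x; simp [halfDisk, hnorm, himx]
    have hmeas : MeasurableSet (toC ⁻¹' (halfDisk r)) :=
      ((halfDisk_open r).preimage toC.continuous).measurableSet
    rw [hset]
    have h1 : ∫ x in toC ⁻¹' (halfDisk r), ∑ i : Fin 2, (fderiv ℝ (fun x => (f (toC x)).im) x
        (EuclideanSpace.single i 1)) ^ 2
        = ∫ x in toC ⁻¹' (halfDisk r), Complex.normSq (deriv f (toC x)) := by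
      refine setIntegral_congr_fun hmeas fun x hx => ?_
      apply grad_im
      refine (hfd.differentiableAt (Metric.isOpen_ball.mem_nhds ?_)).hasDerivAt
      simpa using hx.1
    rw [h1, toC.measurePreserving.setIntegral_preimage_emb
      toC.toHomeomorph.measurableEmbedding (fun z => Complex.normSq (deriv f z))]
    by_cases hint : IntegrableOn (fun z => Complex.normSq (deriv f z)) (halfDisk r)
    · have := energy_bound r hr b C hC (deriv f) hD
      rw [← ofReal_integral_eq_lintegral_ofReal hint
        (Filter.Eventually.of_forall fun z => Complex.normSq_nonneg _)] at this
      exact (ENNReal.ofReal_le_ofReal_iff hC0).1 this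
    · rw [integral_undef hint]; exact hC0

end
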